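/- arXiv:1002.3221 — 2 statements merged into one kernel-verified Lean document; each statement's English description precedes it below -/
import Mathlib

section
/- For every positive integer n, the cyclotomic polynomial Φ_n(X) divides the polynomial R_n(X) − n in ℤ[X]; equivalently, R_n(η) = n for every primitive n-th root of unity η. -/
open Polynomial Finset

/-- Ramanujan sum `c_n(k) = ∑_{d ∣ gcd(n,k)} d·μ(n/d)`. -/
noncomputable def ramanujanSum (n k : ℕ) : ℤ :=
  ∑ d ∈ (Nat.gcd n k).divisors, (d : ℤ) * ArithmeticFunction.moebius (n / d)

/-- `R_n(X) = ∑_{k=0}^{n-1} c_n(k) X^k`. -/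
noncomputable def R (n : ℕ) : Polynomial ℤ :=
  ∑ k ∈ Finset.range n, C (ramanujanSum n k) * X ^ k

theorem sum_range_mul_ite_dvd {M : Type*} [AddCommMonoid M] {d : ℕ} (hd : 0 < d) (e : ℕ)
    (f : ℕ → M) :
    (∑ k ∈ range (d * e), if d ∣ k then f k else 0) = ∑ j ∈ range e, f (d * j) := by
  rw [← sum_filter]
  symm
  refine sum_bij (fun j _ ↦ d * j) ?_ ?_ ?_ fun _ _ ↦ rfl
  · intro j hj
    simp only [mem_filter, mem_range] at hj ⊢
    exact ⟨Nat.mul_lt_mul_of_pos_left hj hd, dvd_mul_right d j⟩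
  · intro a _ b _ h
    exact Nat.eq_of_mul_eq_mul_left hd h
  · intro k hk
    simp only [mem_filter, mem_range] at hk
    obtain ⟨hk, j, rfl⟩ := hk
    exact ⟨j, mem_range.2 (Nat.lt_of_mul_lt_mul_left hk), rfl⟩

theorem ramanujanSum_eq_sum_divisors {n : ℕ} (hn : n ≠ 0) (k : ℕ) :
    ramanujanSum n k =
      ∑ d ∈ n.divisors, if d ∣ k then (d : ℤ) * ArithmeticFunction.moebius (n / d) else 0 := by
  rw [ramanujanSum, ← sum_filter]
  refine sum_congr ?_ fun _ _ ↦ rfl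
  ext d
  simp [Nat.dvd_gcd_iff, hn]

theorem aeval_R_of_isPrimitiveRoot {K : Type*} [CommRing K] [IsDomain K] {n : ℕ} (hn : 0 < n)
    {η : K} (hη : IsPrimitiveRoot η n) : aeval η (R n) = (n : K) := by
  have hR : aeval η (R n) = ∑ d ∈ n.divisors,
      (((d : ℤ) * ArithmeticFunction.moebius (n / d) : ℤ) : K) *
        ∑ k ∈ range n, if d ∣ k then η ^ k else 0 := by
    simp only [R, map_sum, map_mul, map_pow, aeval_X, eq_intCast,
      ramanujanSum_eq_sum_divisors hn.ne', sum_mul, mul_sum]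
    rw [sum_comm]
    refine sum_congr rfl fun d _ ↦ sum_congr rfl fun k _ ↦ ?_
    split_ifs <;> simp
  rw [hR, sum_eq_single_of_mem n (Nat.mem_divisors_self n hn.ne')]
  · have h := sum_range_mul_ite_dvd hn 1 (η ^ ·)
    rw [mul_one] at h
    simp [h, Nat.div_self hn]
  · intro d hd hdn
    obtain ⟨e, rfl⟩ := Nat.dvd_of_mem_divisors hd
    have he : 1 < e := by
      rcases e with _ | _ | e
      · simp at hn
      · simp at hdn
      · omega
    rw [sum_range_mul_ite_dvd (Nat.pos_of_mem_divisors hd)]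
    simp only [pow_mul]
    rw [(hη.pow hn rfl).geom_sum_eq_zero he, mul_zero]

/-- `Φ_n(X)` divides `R_n(X) - n` in `ℤ[X]`; equivalently `R_n(η) = n` for every primitive
`n`-th root of unity `η`. -/
theorem cyclotomic_dvd_R_sub_n (n : ℕ) (hn : 0 < n) :
    cyclotomic n ℤ ∣ (R n - C (n : ℤ)) ∧
    ∀ η : ℂ, IsPrimitiveRoot η n → Polynomial.aeval η (R n) = (n : ℂ) := by
  refine ⟨?_, fun η hη ↦ aeval_R_of_isPrimitiveRoot hn hη⟩
  have hη := Complex.isPrimitiveRoot_exp n hn.ne'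
  rw [cyclotomic_eq_minpoly hη hn]
  refine minpoly.isIntegrallyClosed_dvd (hη.isIntegral hn) ?_
  simp [aeval_R_of_isPrimitiveRoot hn hη]
end

section
/- For every positive integer n, one has the identity T_n(X) = φ(n)·Σ_{d | n} (μ(d)²·f_d(n/d)/φ(d))·(Σ_{j=0}^{d−1} X^{j·(n/d)}) in ℚ[X]; equivalently, T_n(x) = (1 − x^n)·φ(n)·Σ_{d | n} μ(d)²·f_d(n/d)/(φ(d)·(1 − x^{n/d})) for every real x at which all denominators are nonzero. -/
open Polynomial Finset

/-- `T_n(X) = ∑_{k=0}^{n-1} |c_n(k)| X^k`. -/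
noncomputable def T (n : ℕ) : Polynomial ℤ :=
  ∑ k ∈ Finset.range n, C (|ramanujanSum n k|) * X ^ k

/-- `f_k(n) = ∏_{p ∣ n, p ∤ k} (1 - 1/(p-1))`, the product over primes `p` dividing `n`
but not `k`. -/
def f (k n : ℕ) : ℚ :=
  ∏ p ∈ n.primeFactors.filter (fun p => ¬ p ∣ k), (1 - 1 / ((p : ℚ) - 1))

/-- Expansion of a product over the primes of `n` as a sum over squarefree divisors. -/
theorem sum_squarefree_divisors_prod {n : ℕ} (hn : n ≠ 0) (a b : ℕ → ℚ) :
    ∑ d ∈ n.divisors with Squarefree d, ∏ p ∈ n.primeFactors, (if p ∣ d then a p else b p) =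
      ∏ p ∈ n.primeFactors, (a p + b p) := by
  rw [Finset.prod_add]
  refine Finset.sum_bij' (fun d _ => d.primeFactors) (fun t _ => ∏ p ∈ t, p) ?_ ?_ ?_ ?_ ?_
  · intro d hd
    simp only [mem_filter, Nat.mem_divisors] at hd
    exact mem_powerset.2 (Nat.primeFactors_mono hd.1.1 hn)
  · intro t ht
    have ht := mem_powerset.1 ht
    have hdvd : ∏ p ∈ t, p ∣ n :=
      (prod_dvd_prod_of_subset _ _ _ ht).trans (Nat.prod_primeFactors_dvd n)
    simp only [mem_filter, Nat.mem_divisors]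
    refine ⟨⟨hdvd, hn⟩, ?_⟩
    refine Finset.squarefree_prod_of_pairwise_isCoprime ?_ ?_
    · intro p hp q hq hpq
      exact Nat.coprime_iff_isRelPrime.1 ((Nat.coprime_primes (Nat.prime_of_mem_primeFactors (ht hp))
        (Nat.prime_of_mem_primeFactors (ht hq))).2 hpq)
    · intro p hp
      exact (Nat.prime_of_mem_primeFactors (ht hp)).prime.squarefree
  · intro d hd
    exact Nat.prod_primeFactors_of_squarefree (mem_filter.1 hd).2
  · intro t ht
    exact Nat.primeFactors_prod fun p hp =>
      Nat.prime_of_mem_primeFactors (mem_powerset.1 ht hp)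
  · intro d hd
    simp only [mem_filter, Nat.mem_divisors] at hd
    have hd0 : d ≠ 0 := ne_zero_of_dvd_ne_zero hn hd.1.1
    rw [prod_ite]
    congr 1 <;> refine prod_congr ?_ fun _ _ => rfl
    · ext p
      simp only [mem_filter, Nat.mem_primeFactors]
      exact ⟨fun h => ⟨h.1.1, h.2, hd0⟩, fun h => ⟨⟨h.1, h.2.1.trans hd.1.1, hn⟩, h.2.1⟩⟩
    · ext p
      simp only [mem_filter, mem_sdiff, Nat.mem_primeFactors]
      exact ⟨fun h => ⟨h.1, fun h' => h.2 h'.2.1⟩, fun h => ⟨h.1, fun h' => h.2 ⟨h.1.1, h', hd0⟩⟩⟩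

theorem totient_cast_of_squarefree {d : ℕ} (hd : Squarefree d) :
    (d.totient : ℚ) = ∏ p ∈ d.primeFactors, ((p : ℚ) - 1) := by
  rw [Nat.totient_eq_mul_prod_factors]
  nth_rewrite 1 [← Nat.prod_primeFactors_of_squarefree hd]
  rw [Nat.cast_prod, ← prod_mul_distrib]
  refine prod_congr rfl fun p hp => ?_
  have : (p : ℚ) ≠ 0 := by exact_mod_cast (Nat.prime_of_mem_primeFactors hp).ne_zero
  field_simp

theorem moebius_cast_of_squarefree {d : ℕ} (hd : Squarefree d) :
    (ArithmeticFunction.moebius d : ℚ) = ∏ _p ∈ d.primeFactors, (-1 : ℚ) := by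
  rw [ArithmeticFunction.moebius_apply_of_squarefree hd, prod_const,
    (ArithmeticFunction.cardDistinctFactors_eq_cardFactors_iff_squarefree
      hd.ne_zero).2 hd |>.symm]
  rw [ArithmeticFunction.cardDistinctFactors_apply, Nat.primeFactors, List.card_toFinset]
  push_cast
  rfl

theorem filter_dvd_primeFactors {n d : ℕ} (hn : n ≠ 0) (hd : d ∣ n) :
    n.primeFactors.filter (· ∣ d) = d.primeFactors := by
  ext p
  simp only [mem_filter, Nat.mem_primeFactors]
  exact ⟨fun h => ⟨h.1.1, h.2, ne_zero_of_dvd_ne_zero hn hd⟩,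
    fun h => ⟨⟨h.1, h.2.1.trans hd, hn⟩, h.2.1⟩⟩

theorem filter_not_dvd_primeFactors_mul {d m : ℕ} (hd : d ≠ 0) (hm : m ≠ 0) :
    (d * m).primeFactors.filter (fun p => ¬ p ∣ d) = m.primeFactors.filter (fun p => ¬ p ∣ d) := by
  ext p
  simp only [mem_filter, Nat.primeFactors_mul hd hm, mem_union, Nat.mem_primeFactors]
  tauto

theorem sum_moebius_div_coprime {g : ℕ} (hg : g ≠ 0) (r : ℕ) :
    ∑ e ∈ g.divisors, (if e.Coprime r then (ArithmeticFunction.moebius e : ℚ) / e else 0) =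
      ∏ p ∈ g.primeFactors with ¬ p ∣ r, (1 - (p : ℚ)⁻¹) := by
  have key := sum_squarefree_divisors_prod hg (fun p => if p ∣ r then 0 else -(p : ℚ)⁻¹) 1
  rw [prod_filter]
  trans ∏ p ∈ g.primeFactors, ((if p ∣ r then 0 else -(p : ℚ)⁻¹) + (1 : ℕ → ℚ) p)
  · rw [← key, sum_filter]
    refine sum_congr rfl fun e he => ?_
    have he := Nat.mem_divisors.1 he
    split_ifs with h1 h2 h2
    · rw [← prod_filter_mul_prod_filter_not _ (· ∣ e), filter_dvd_primeFactors hg he.1]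
      rw [prod_eq_one (s := filter (fun p => ¬ p ∣ e) _), mul_one, moebius_cast_of_squarefree h2]
      · nth_rewrite 2 [← Nat.prod_primeFactors_of_squarefree h2]
        rw [Nat.cast_prod, ← prod_div_distrib]
        refine prod_congr rfl fun p hp => ?_
        rw [if_pos (Nat.dvd_of_mem_primeFactors hp), if_neg, neg_div, one_div]
        exact fun h => (Nat.prime_of_mem_primeFactors hp).one_lt.ne'
          (Nat.eq_one_of_dvd_coprimes h1 (Nat.dvd_of_mem_primeFactors hp) h)
      · intro p hp
        rw [if_neg (mem_filter.1 hp).2, Pi.one_apply]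
    · rw [ArithmeticFunction.moebius_eq_zero_of_not_squarefree h2]
      simp
    · obtain ⟨p, hp, hpe, hpr⟩ := Nat.Prime.not_coprime_iff_dvd.1 h1
      refine (prod_eq_zero (Nat.mem_primeFactors.2 ⟨hp, hpe.trans he.1, hg⟩) ?_).symm
      simp [hpe, hpr]
    · rfl
  · refine prod_congr rfl fun p _ => ?_
    by_cases h : p ∣ r
    · simp [h]
    · simp [h]; ring

theorem moebius_mul_eq_ite (r e : ℕ) : ArithmeticFunction.moebius (r * e) =
    if e.Coprime r then ArithmeticFunction.moebius r * ArithmeticFunction.moebius e else 0 := by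
  split_ifs with h
  · exact ArithmeticFunction.isMultiplicative_moebius.map_mul_of_coprime h.symm
  · exact ArithmeticFunction.moebius_eq_zero_of_not_squarefree fun hs =>
      h (Nat.coprime_of_squarefree_mul hs).symm

/-- Hölder's evaluation of the Ramanujan sum. -/
theorem ramanujanSum_eq {n : ℕ} (hn : n ≠ 0) (k : ℕ) :
    (ramanujanSum n k : ℚ) = ArithmeticFunction.moebius (n / n.gcd k) *
      (n.totient / (n / n.gcd k).totient) := by
  obtain ⟨r, hr⟩ := Nat.gcd_dvd_left n k
  rw [ramanujanSum]
  set g := n.gcd k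
  have hg : g ≠ 0 := by rintro h; simp [h] at hr; exact hn hr
  have hr0 : r ≠ 0 := by rintro h; simp [h] at hr; exact hn hr
  have hnr : n / g = r := by rw [hr, Nat.mul_div_cancel_left _ (Nat.pos_of_ne_zero hg)]
  rw [hnr, ← Nat.sum_div_divisors]
  have h1 : (((∑ d ∈ g.divisors, ((g / d : ℕ) : ℤ) *
      ArithmeticFunction.moebius (n / (g / d)) : ℤ)) : ℚ) =
      g * ArithmeticFunction.moebius r * ∑ e ∈ g.divisors,
        (if e.Coprime r then (ArithmeticFunction.moebius e : ℚ) / e else 0) := by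
    rw [mul_sum]
    simp only [Int.cast_sum, Int.cast_mul, Int.cast_natCast]
    refine sum_congr rfl fun e he => ?_
    obtain ⟨q, hq⟩ := Nat.dvd_of_mem_divisors he
    have he0 : e ≠ 0 := by rintro rfl; simp at hq; exact hg hq
    have hq0 : q ≠ 0 := by rintro rfl; simp at hq; exact hg hq
    have e1 : g / e = q := by rw [hq, Nat.mul_div_cancel_left _ (Nat.pos_of_ne_zero he0)]
    have e2 : n / q = r * e := by
      rw [hr, hq, show e * q * r = q * (r * e) by ring,
        Nat.mul_div_cancel_left _ (Nat.pos_of_ne_zero hq0)]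
    rw [e1, e2, moebius_mul_eq_ite, hq]
    have : (e : ℚ) ≠ 0 := by exact_mod_cast he0
    split_ifs
    · push_cast
      field_simp
    · simp
  rw [h1, sum_moebius_div_coprime hg, Nat.totient_eq_mul_prod_factors n,
    Nat.totient_eq_mul_prod_factors r,
    ← prod_filter_mul_prod_filter_not n.primeFactors (· ∣ r),
    filter_dvd_primeFactors hn ⟨g, by rw [hr, mul_comm]⟩,
    show n.primeFactors.filter (fun p => ¬ p ∣ r) = g.primeFactors.filter (fun p => ¬ p ∣ r) by
      rw [hr, mul_comm]; exact filter_not_dvd_primeFactors_mul hr0 hg]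
  have hP : ∏ p ∈ r.primeFactors, (1 - (p : ℚ)⁻¹) ≠ 0 := by
    refine prod_ne_zero_iff.2 fun p hp => ?_
    have := (Nat.prime_of_mem_primeFactors hp).one_lt
    exact sub_ne_zero.2 (inv_lt_one_of_one_lt₀ (by exact_mod_cast this)).ne'
  have hr' : (r : ℚ) ≠ 0 := by exact_mod_cast hr0
  rw [show (n : ℚ) = g * r by exact_mod_cast hr]
  generalize ∏ p ∈ r.primeFactors, (1 - (p : ℚ)⁻¹) = P at *
  field_simp

theorem coeff_eq_prod {n d : ℕ} (hn : n ≠ 0) (hd : d ∣ n) (hs : Squarefree d) :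
    (ArithmeticFunction.moebius d : ℚ) ^ 2 * f d (n / d) / (d.totient : ℚ) =
      ∏ p ∈ n.primeFactors, (if p ∣ d then 1 / ((p : ℚ) - 1) else 1 - 1 / ((p : ℚ) - 1)) := by
  obtain ⟨m, rfl⟩ := hd
  have hd0 : d ≠ 0 := left_ne_zero_of_mul hn
  have hm0 : m ≠ 0 := right_ne_zero_of_mul hn
  rw [prod_ite, filter_dvd_primeFactors hn ⟨m, rfl⟩, filter_not_dvd_primeFactors_mul hd0 hm0,
    Nat.mul_div_cancel_left _ (Nat.pos_of_ne_zero hd0), f, totient_cast_of_squarefree hs,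
    show (ArithmeticFunction.moebius d : ℚ) ^ 2 = 1 by
      exact_mod_cast ArithmeticFunction.moebius_sq_eq_one_of_squarefree hs]
  simp only [one_div, prod_inv_distrib]
  ring

theorem sum_coeff_of_dvd {n r : ℕ} (hn : n ≠ 0) (hr : r ∣ n) :
    ∑ d ∈ n.divisors, (if r ∣ d then
      (ArithmeticFunction.moebius d : ℚ) ^ 2 * f d (n / d) / (d.totient : ℚ) else 0) =
      (ArithmeticFunction.moebius r : ℚ) ^ 2 / r.totient := by
  by_cases hs : Squarefree r
  · have key := sum_squarefree_divisors_prod hn (fun p => 1 / ((p : ℚ) - 1))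
      (fun p => if p ∣ r then 0 else 1 - 1 / ((p : ℚ) - 1))
    rw [sum_filter] at key
    trans ∏ p ∈ n.primeFactors, (1 / ((p : ℚ) - 1) +
      if p ∣ r then 0 else 1 - 1 / ((p : ℚ) - 1))
    · rw [← key]
      refine sum_congr rfl fun d hd => ?_
      have hdn := Nat.dvd_of_mem_divisors hd
      split_ifs with h1 h2 h2
      · rw [coeff_eq_prod hn hdn h2]
        refine prod_congr rfl fun p _ => ?_
        by_cases hp : p ∣ d
        · simp [hp]
        · simp [hp, mt (fun h : p ∣ r => h.trans h1) hp]
      · rw [ArithmeticFunction.moebius_eq_zero_of_not_squarefree h2]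
        simp
      · have : ∃ p ∈ r.primeFactors, ¬ p ∣ d := by
          by_contra! h
          refine h1 ?_
          rw [← Nat.prod_primeFactors_of_squarefree hs]
          exact Finset.prod_primes_dvd _ (fun p hp => (Nat.prime_of_mem_primeFactors hp).prime) h
        obtain ⟨p, hp, hpd⟩ := this
        refine (prod_eq_zero (Nat.primeFactors_mono hr hn hp) ?_).symm
        simp [hpd, Nat.dvd_of_mem_primeFactors hp]
      · rfl
    · rw [show (ArithmeticFunction.moebius r : ℚ) ^ 2 = 1 by
        exact_mod_cast ArithmeticFunction.moebius_sq_eq_one_of_squarefree hs,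
        totient_cast_of_squarefree hs, one_div, ← prod_inv_distrib,
        ← filter_dvd_primeFactors hn hr, prod_filter]
      refine prod_congr rfl fun p _ => ?_
      by_cases hp : p ∣ r <;> simp [hp]
  · rw [ArithmeticFunction.moebius_eq_zero_of_not_squarefree hs]
    simp only [Int.cast_zero, ne_eq, OfNat.ofNat_ne_zero, not_false_eq_true, zero_pow, zero_div]
    refine sum_eq_zero fun d _ => ?_
    split_ifs with h
    · rw [ArithmeticFunction.moebius_eq_zero_of_not_squarefree fun h' =>
        hs (h'.squarefree_of_dvd h)]
      simp
    · rfl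

theorem div_dvd_iff_div_gcd_dvd {n d : ℕ} (hn : n ≠ 0) (hd : d ∣ n) (k : ℕ) :
    n / d ∣ k ↔ n / n.gcd k ∣ d := by
  rw [Nat.div_dvd_iff_dvd_mul hd (Nat.pos_of_dvd_of_pos hd (Nat.pos_of_ne_zero hn)),
    Nat.div_dvd_iff_dvd_mul (Nat.gcd_dvd_left n k) (Nat.gcd_pos_of_pos_left _
      (Nat.pos_of_ne_zero hn)), mul_comm (n.gcd k), Nat.dvd_mul_gcd_iff_dvd_mul, mul_comm]

theorem abs_ramanujanSum_eq {n : ℕ} (hn : n ≠ 0) (k : ℕ) :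
    |(ramanujanSum n k : ℚ)| = n.totient * ∑ d ∈ n.divisors, (if n / d ∣ k then
      (ArithmeticFunction.moebius d : ℚ) ^ 2 * f d (n / d) / (d.totient : ℚ) else 0) := by
  have h : ∀ d ∈ n.divisors, (n / d ∣ k ↔ n / n.gcd k ∣ d) := fun d hd =>
    div_dvd_iff_div_gcd_dvd hn (Nat.dvd_of_mem_divisors hd) k
  rw [sum_congr rfl fun d hd => by rw [if_congr (h d hd) rfl rfl],
    sum_coeff_of_dvd hn (Nat.div_dvd_of_dvd (Nat.gcd_dvd_left n k)), ramanujanSum_eq hn, abs_mul,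
    abs_of_nonneg (a := (n.totient : ℚ) / _) (by positivity)]
  have hmu : |(ArithmeticFunction.moebius (n / n.gcd k) : ℚ)| =
      (ArithmeticFunction.moebius (n / n.gcd k) : ℚ) ^ 2 := by
    rcases ArithmeticFunction.moebius_eq_or (n / n.gcd k) with h | h | h <;> rw [h] <;> simp
  rw [hmu]
  ring

theorem sum_range_pow_mul {R : Type*} [Semiring R] (x : R) (d : ℕ) {m : ℕ} (hm : 0 < m) :
    ∑ j ∈ range d, x ^ (j * m) = ∑ k ∈ range (d * m), if m ∣ k then x ^ k else 0 := by
  rw [← sum_filter]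
  refine sum_bij' (fun j _ => j * m) (fun k _ => k / m) ?_ ?_ ?_ ?_ ?_
  · intro j hj
    simpa [hm] using mem_range.1 hj
  · intro k hk
    simp only [mem_filter, mem_range] at hk ⊢
    exact Nat.div_lt_of_lt_mul (by rw [mul_comm]; exact hk.1)
  · intro j _
    exact Nat.mul_div_cancel _ hm
  · intro k hk
    exact Nat.div_mul_cancel (mem_filter.1 hk).2
  · intro j _
    rfl

theorem T_map_eq {n : ℕ} (hn : 0 < n) : (T n).map (Int.castRingHom ℚ) =
      C ((Nat.totient n : ℚ)) * ∑ d ∈ n.divisors,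
        C ((ArithmeticFunction.moebius d : ℚ) ^ 2 * f d (n / d) / (Nat.totient d : ℚ)) *
          ∑ j ∈ Finset.range d, X ^ (j * (n / d)) := by
  have h : ∀ d ∈ n.divisors, ∑ j ∈ Finset.range d, (X : ℚ[X]) ^ (j * (n / d)) =
      ∑ k ∈ range n, if n / d ∣ k then X ^ k else 0 := by
    intro d hd
    have hd := Nat.dvd_of_mem_divisors hd
    rw [sum_range_pow_mul _ _ (Nat.div_pos (Nat.le_of_dvd hn hd) (Nat.pos_of_dvd_of_pos hd hn)),
      Nat.mul_div_cancel' hd]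
  rw [sum_congr rfl fun d hd => by rw [h d hd, mul_sum], sum_comm, mul_sum, T,
    Polynomial.map_sum]
  refine sum_congr rfl fun k _ => ?_
  rw [Polynomial.map_mul, Polynomial.map_pow, map_X, map_C, eq_intCast, Int.cast_abs,
    abs_ramanujanSum_eq hn.ne', C_mul, mul_assoc, map_sum, sum_mul]
  congr 1
  refine sum_congr rfl fun d _ => ?_
  split_ifs <;> simp

/-- `T_n(X) = φ(n)·∑_{d ∣ n} (μ(d)²·f_d(n/d)/φ(d))·∑_{j=0}^{d-1} X^{j(n/d)}` in `ℚ[X]`;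
equivalently, for real `x` with all denominators nonzero,
`T_n(x) = (1-x^n)·φ(n)·∑_{d ∣ n} μ(d)²·f_d(n/d)/(φ(d)(1-x^{n/d}))`. -/
theorem T_eq_sum_divisors (n : ℕ) (hn : 0 < n) :
    ((T n).map (Int.castRingHom ℚ) =
      C ((Nat.totient n : ℚ)) * ∑ d ∈ n.divisors,
        C ((ArithmeticFunction.moebius d : ℚ) ^ 2 * f d (n / d) / (Nat.totient d : ℚ)) *
          ∑ j ∈ Finset.range d, X ^ (j * (n / d))) ∧
    ∀ x : ℝ, (∀ d ∈ n.divisors, (1 : ℝ) - x ^ (n / d) ≠ 0) →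
      Polynomial.aeval x (T n) = (1 - x ^ n) * (Nat.totient n : ℝ) *
        ∑ d ∈ n.divisors,
          (ArithmeticFunction.moebius d : ℝ) ^ 2 * (f d (n / d) : ℝ) /
            ((Nat.totient d : ℝ) * (1 - x ^ (n / d))) := by
  refine ⟨T_map_eq hn, fun x hx => ?_⟩
  have h := congrArg (aeval x) (T_map_eq hn)
  have hT : aeval x ((T n).map (Int.castRingHom ℚ)) = aeval x (T n) :=
    aeval_map_algebraMap ℚ x (T n)
  rw [hT] at h
  rw [h, map_mul, aeval_C, map_sum, mul_comm (1 - x ^ n), mul_assoc, mul_sum _ _ (1 - x ^ n)]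
  simp only [eq_ratCast, Rat.cast_natCast]
  congr 1
  refine sum_congr rfl fun d hd => ?_
  have hx' := hx d hd
  have hg : (∑ j ∈ range d, x ^ (j * (n / d))) * (1 - x ^ (n / d)) = 1 - x ^ n := by
    have := geom_sum_mul_neg (x ^ (n / d)) d
    rw [← pow_mul, Nat.div_mul_cancel (Nat.dvd_of_mem_divisors hd)] at this
    rw [← this]
    congr 1
    exact sum_congr rfl fun j _ => by rw [← pow_mul, mul_comm]
  rw [← hg, map_mul, aeval_C, map_sum]
  simp only [map_pow, aeval_X, eq_ratCast]
  push_cast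
  field_simp
end
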